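/- Suppose the pair (F^c, F^o) satisfies the system of closed and open WDVV equations on M̃. Then the function u := ∂F^o/∂t^{N+1} satisfies ∂u/∂t^α · ∂u/∂t^β = Σ_{γ=1}^{N+1} c̃^γ_{αβ} · ∂u/∂t^γ on M̃ for all 1 ≤ α, β ≤ N+1 (this is the system of PDEs whose distinct solutions are the canonical coordinates of the flat F-manifold defined by (F^c, F^o); hence ∂F^o/∂t^{N+1} extends a system of canonical coordinates of F^c to canonical coordinates of the flat F-manifold given by the pair). -/

import Mathlib

/-- The partial derivative `∂f/∂t^i` of a function of `n` complex variables. -/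
noncomputable def pd {n : ℕ} (i : Fin n) (f : (Fin n → ℂ) → ℂ) : (Fin n → ℂ) → ℂ :=
  fun x => fderiv ℂ f x (Pi.single i 1)

theorem analyticOnNhd_pd {n : ℕ} {f : (Fin n → ℂ) → ℂ} {S : Set (Fin n → ℂ)}
    (hf : AnalyticOnNhd ℂ f S) (i : Fin n) : AnalyticOnNhd ℂ (pd i f) S := fun x hx =>
  ((ContinuousLinearMap.apply ℂ ℂ (Pi.single i 1 : Fin n → ℂ)).analyticAt _).comp
    (hf.fderiv x hx)

theorem pd_congr {n : ℕ} {f g : (Fin n → ℂ) → ℂ} {S : Set (Fin n → ℂ)} (hS : IsOpen S)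
    (h : Set.EqOn f g S) (i : Fin n) : Set.EqOn (pd i f) (pd i g) S := fun x hx => by
  unfold pd
  rw [(h.eventuallyEq_of_mem (hS.mem_nhds hx)).fderiv_eq]

theorem pd_pd_eq_fderiv_fderiv {n : ℕ} {f : (Fin n → ℂ) → ℂ} {x : Fin n → ℂ}
    (hf : AnalyticAt ℂ f x) (i j : Fin n) :
    pd i (pd j f) x = fderiv ℂ (fderiv ℂ f) x (Pi.single i 1) (Pi.single j 1) := by
  unfold pd
  rw [fderiv_clm_apply hf.fderiv.differentiableAt (differentiableAt_const _)]
  simp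

theorem pd_comm {n : ℕ} {f : (Fin n → ℂ) → ℂ} {x : Fin n → ℂ}
    (hf : AnalyticAt ℂ f x) (i j : Fin n) : pd i (pd j f) x = pd j (pd i f) x := by
  rw [pd_pd_eq_fderiv_fderiv hf, pd_pd_eq_fderiv_fderiv hf]
  exact (hf.contDiffAt.isSymmSndFDerivAt (n := ⊤) (by simp)).eq _ _

theorem pd_pd_pd_rotate {n : ℕ} {f : (Fin n → ℂ) → ℂ} {S : Set (Fin n → ℂ)} (hS : IsOpen S)
    (hf : AnalyticOnNhd ℂ f S) {x : Fin n → ℂ} (hx : x ∈ S) (i j k : Fin n) :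
    pd i (pd j (pd k f)) x = pd j (pd k (pd i f)) x := by
  rw [pd_comm (analyticOnNhd_pd hf k x hx)]
  exact pd_congr hS (fun y hy => pd_comm (hf y hy) i k) j hx

/-- Partial derivatives of a function invariant under a translation are again invariant. -/
theorem pd_add_of_forall_add {n : ℕ} {f : (Fin n → ℂ) → ℂ} {v : Fin n → ℂ}
    (h : ∀ x, f (x + v) = f x) (i : Fin n) (x : Fin n → ℂ) : pd i f (x + v) = pd i f x := by
  unfold pd
  rw [← fderiv_comp_add_right, funext h]

theorem pd_eq_zero_of_forall_add {n : ℕ} {f : (Fin n → ℂ) → ℂ} {i : Fin n}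
    (h : ∀ (s : ℂ) x, f (x + Pi.single i s) = f x) (x : Fin n → ℂ) : pd i f x = 0 := by
  unfold pd
  by_cases hf : DifferentiableAt ℂ f x
  · rw [← hf.lineDeriv_eq_fderiv, lineDeriv]
    have hconst : (fun s : ℂ => f (x + s • Pi.single i 1)) = fun _ => f x := by
      funext s
      simpa [← Pi.single_smul] using h s x
    rw [hconst, deriv_const]
  · simp [fderiv_zero_of_not_differentiableAt hf]

/-- if `(F^c, F^o)` satisfies the system of closed and open WDVV equations on `M̃`,
then `u := ∂F^o/∂t^{N+1}` satisfies `∂u/∂t^α ∂u/∂t^β = Σ_γ c̃^γ_{αβ} ∂u/∂t^γ` on `M̃`. -/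
theorem canonical_coordinate_from_open_potential (N : ℕ) (hN : 1 ≤ N)
    (η : Matrix (Fin N) (Fin N) ℂ) (hsym : η.IsSymm) (hinv : IsUnit η.det)
    (M : Set (Fin N → ℂ)) (hM : IsOpen M)
    (U : Set ℂ) (hU : IsOpen U)
    (Fc : (Fin N → ℂ) → ℂ) (Fo : (Fin (N + 1) → ℂ) → ℂ)
    (Mt : Set (Fin (N + 1) → ℂ))
    (hMt : Mt = {t | (fun i : Fin N => t i.castSucc) ∈ M ∧ t (Fin.last N) ∈ U})
    (hFc : AnalyticOnNhd ℂ Fc M) (hFo : AnalyticOnNhd ℂ Fo Mt)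
    -- `F^c` regarded as a function on `M̃ ⊆ ℂ^{N+1}`, independent of the last coordinate:
    (Fc' : (Fin (N + 1) → ℂ) → ℂ) (hFc' : Fc' = fun t => Fc fun i : Fin N => t i.castSucc)
    -- the tensor `c̃`:
    (ct : Fin (N + 1) → Fin (N + 1) → Fin (N + 1) → (Fin (N + 1) → ℂ) → ℂ)
    (hct : ∀ α β γ t, ct α β γ t =
      if h : (α : ℕ) < N then
        ∑ μ : Fin N, η⁻¹ ⟨(α : ℕ), h⟩ μ * pd μ.castSucc (pd β (pd γ Fc')) t
      else pd β (pd γ Fo) t)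
    -- the closed WDVV equations hold on M̃:
    (hclosed : ∀ t ∈ Mt, ∀ α β γ δ : Fin N,
        ∑ μ : Fin N, ∑ ν : Fin N,
          pd α.castSucc (pd β.castSucc (pd μ.castSucc Fc')) t * η⁻¹ μ ν *
            pd ν.castSucc (pd γ.castSucc (pd δ.castSucc Fc')) t =
        ∑ μ : Fin N, ∑ ν : Fin N,
          pd δ.castSucc (pd β.castSucc (pd μ.castSucc Fc')) t * η⁻¹ μ ν *
            pd ν.castSucc (pd γ.castSucc (pd α.castSucc Fc')) t)
    -- the open WDVV equations hold on M̃: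
    (hopen : ∀ t ∈ Mt, ∀ α β γ : Fin (N + 1),
        (∑ μ : Fin N, ∑ ν : Fin N,
          pd α (pd β (pd μ.castSucc Fc')) t * η⁻¹ μ ν * pd ν.castSucc (pd γ Fo) t)
          + pd α (pd β Fo) t * pd (Fin.last N) (pd γ Fo) t =
        (∑ μ : Fin N, ∑ ν : Fin N,
          pd γ (pd β (pd μ.castSucc Fc')) t * η⁻¹ μ ν * pd ν.castSucc (pd α Fo) t)
          + pd γ (pd β Fo) t * pd (Fin.last N) (pd α Fo) t)
    -- `u := ∂F^o/∂t^{N+1}`: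
    (u : (Fin (N + 1) → ℂ) → ℂ) (hu : u = pd (Fin.last N) Fo) :
    ∀ t ∈ Mt, ∀ α β : Fin (N + 1),
      pd α u t * pd β u t = ∑ γ : Fin (N + 1), ct γ α β t * pd γ u t := by
  intro t ht α β
  have hinit : Continuous fun (t : Fin (N + 1) → ℂ) (i : Fin N) => t i.castSucc := by fun_prop
  have hMto : IsOpen Mt := by
    rw [hMt]
    exact (hM.preimage hinit).inter (hU.preimage (continuous_apply _))
  have hFca : AnalyticOnNhd ℂ Fc' Mt := by
    intro x hx
    rw [hMt] at hx
    let L : (Fin (N + 1) → ℂ) →L[ℂ] (Fin N → ℂ) :=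
      ContinuousLinearMap.pi fun i => ContinuousLinearMap.proj i.castSucc
    rw [hFc']
    exact AnalyticAt.comp (f := L) (hFc _ hx.1) (L.analyticAt x)
  have hzero (μ : Fin N) : pd (Fin.last N) (pd β (pd μ.castSucc Fc')) t = 0 := by
    refine pd_eq_zero_of_forall_add (fun s => pd_add_of_forall_add (pd_add_of_forall_add ?_ _) _) t
    intro x
    simp [hFc', Fin.castSucc_ne_last]
  have hsymm : (η⁻¹).IsSymm := hsym.inv
  have key := hopen t ht α β (Fin.last N)
  simp only [hzero, zero_mul, Finset.sum_const_zero, zero_add] at key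
  rw [pd_comm (hFo t ht) (Fin.last N) β, pd_comm (hFo t ht) (Fin.last N) α] at key
  rw [hu, mul_comm, ← key, Fin.sum_univ_castSucc, Finset.sum_comm]
  congr 1
  · refine Finset.sum_congr rfl fun ν _ => ?_
    simp only [hct, Fin.val_castSucc, Fin.is_lt, dite_true, Fin.eta, Finset.sum_mul]
    refine Finset.sum_congr rfl fun μ _ => ?_
    rw [pd_pd_pd_rotate hMto hFca ht μ.castSucc, hsymm.apply ν μ]
    ring
  · simp [hct]
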